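/- Let m ≥ 2 be an integer and c_1, …, c_m positive integers; set n = m − 1 + ∑_{l=1}^m c_l (so that ∑_{l=1}^m c_l = n − m + 1) and N = n − m + 1. Let α_1, …, α_N be pairwise distinct nonzero complex numbers. Then ∑_{i=1}^{N} ∑_{j≠i} [ α_i^{m} · ∏_{l=1}^{m} ( c_l · ∏_{a=1}^{c_l−1} ((c_l − a)α_j + a·α_i) ) / ((α_j − α_i)·∏_{k≠i,j}(α_j − α_k)) ] · ( ∑_{k≠i,j} 1/(α_i − α_k) − ∑_{l=1}^{m} 1/(c_l·α_i) ) = ( ∑_{l=1}^{m} 1/c_l − (n − 2m + 1)/2 ) · ∏_{l=1}^{m} c_l^{c_l}. -/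

import Mathlib

open Finset

open Polynomial in
lemma aux_logder {ι : Type*} [DecidableEq ι] (s : Finset ι) (f : ι → ℂ[X]) (e : ι → ℂ) (t x : ℂ)
    (h : ∀ l ∈ s, t * (derivative (f l)).eval x = e l * (f l).eval x) :
    t * (derivative (∏ l ∈ s, f l)).eval x = (∑ l ∈ s, e l) * (∏ l ∈ s, f l).eval x := by
  rw [derivative_prod_finset, eval_finsetSum, mul_sum, sum_mul]
  refine sum_congr rfl fun l hl => ?_
  rw [eval_mul, ← mul_prod_erase s f hl, eval_mul]
  linear_combination (∏ l ∈ s.erase l, f l).eval x * h l hl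

open Polynomial in
lemma aux_lag {N : ℕ} (α : Fin N → ℂ) (hα : Function.Injective α) (hN : 2 ≤ N)
    (h : ℂ[X]) (hd : h.natDegree < N - 1) (i : Fin N) :
    ∑ j ∈ univ.erase i, h.eval (α j) / ∏ k ∈ univ.erase j, (α j - α k) =
      - (h.eval (α i) / ∏ k ∈ univ.erase i, (α i - α k)) := by
  have h1 : h.degree < #(univ : Finset (Fin N)) := by
    refine lt_of_le_of_lt degree_le_natDegree ?_
    rw [card_univ, Fintype.card_fin]
    exact_mod_cast (by omega : h.natDegree < N)
  have := Lagrange.coeff_eq_sum (s := univ) (v := α) hα.injOn h1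
  rw [card_univ, Fintype.card_fin, coeff_eq_zero_of_natDegree_lt hd,
    ← add_sum_erase _ _ (mem_univ i)] at this
  linear_combination -this

open Polynomial in
lemma aux_dd {N : ℕ} (α : Fin N → ℂ) (hα : Function.Injective α) (hN : 2 ≤ N)
    (h : ℂ[X]) (hd : h.natDegree ≤ N - 1) (i : Fin N) :
    ∑ j ∈ univ.erase i, (h.eval (α j) - h.eval (α i)) /
        ((α j - α i) * ∏ k ∈ univ.erase j, (α j - α k)) =
      - ((derivative h).eval (α i) / ∏ k ∈ univ.erase i, (α i - α k)) := by
  set g := h /ₘ (X - C (α i)) with hg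
  have hgd : g.natDegree < N - 1 := by
    rw [hg, natDegree_divByMonic _ (monic_X_sub_C _), natDegree_X_sub_C]; omega
  have e1 := X_sub_C_mul_divByMonic_eq_sub_modByMonic h (α i)
  have e2 := divByMonic_add_X_sub_C_mul_derivative_divByMonic_eq_derivative h (α i)
  rw [modByMonic_X_sub_C_eq_C_eval, ← hg] at e1
  rw [← hg] at e2
  have e3 : (derivative h).eval (α i) = g.eval (α i) := by
    rw [← e2]; simp
  rw [e3, ← aux_lag α hα hN g hgd i]
  refine sum_congr rfl fun j hj => ?_
  have hne : α j - α i ≠ 0 := sub_ne_zero.2 (fun hh => (mem_erase.1 hj).1 (hα hh))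
  have e4 := congrArg (eval (α j)) e1
  simp only [eval_mul, eval_sub, eval_X, eval_C] at e4
  rw [← e4, mul_div_mul_left _ _ hne]

open Polynomial in
lemma aux_S3 {N : ℕ} (α : Fin N → ℂ) (hα : Function.Injective α) (hN : 2 ≤ N) (i : Fin N) :
    ∑ j ∈ univ.erase i, 1 / ((α j - α i) * ∏ k ∈ univ.erase j, (α j - α k)) =
      (∑ k ∈ univ.erase i, 1 / (α i - α k)) / ∏ k ∈ univ.erase i, (α i - α k) := by
  set Q : ℂ[X] := ∏ k ∈ univ.erase i, (X - C (α k)) with hQ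
  set D := ∏ k ∈ univ.erase i, (α i - α k) with hD
  have hne : ∀ k ∈ univ.erase i, α i - α k ≠ 0 := fun k hk =>
    sub_ne_zero.2 (fun hh => (mem_erase.1 hk).1 (hα hh).symm)
  have hD0 : D ≠ 0 := prod_ne_zero_iff.2 hne
  have hQi : Q.eval (α i) = D := by simp [hQ, hD, eval_prod]
  have hQd : Q.natDegree ≤ N - 1 := by
    rw [hQ, natDegree_prod_of_monic _ _ (fun k _ => monic_X_sub_C _)]; simp
  have hder := aux_logder (univ.erase i) (fun k => (X - C (α k) : ℂ[X]))
    (fun k => 1 / (α i - α k)) 1 (α i) (fun k hk => by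
      have := hne k hk
      simp; field_simp)
  rw [← hQ, one_mul, hQi] at hder
  have h := aux_dd α hα hN Q hQd i
  rw [hder, ← hD, mul_div_assoc, div_self hD0, mul_one, hQi] at h
  rw [eq_div_iff hD0, ← neg_inj, ← h, ← neg_mul, ← sum_neg_distrib, sum_mul]
  refine sum_congr rfl fun j hj => ?_
  have : Q.eval (α j) = 0 := by
    rw [hQ, eval_prod]; exact prod_eq_zero hj (by simp)
  rw [this]; ring

lemma aux_sum (c : ℕ) (hc : 0 < c) :
    ∑ a ∈ Icc 1 (c - 1), ((c : ℂ) - a) / c = ((c : ℂ) - 1) / 2 := by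
  have hc0 : (c : ℂ) ≠ 0 := by exact_mod_cast hc.ne'
  have : ∀ d : ℕ, ∑ a ∈ Icc 1 d, ((c : ℂ) - a) = d * c - d * (d + 1) / 2 := by
    intro d
    induction d with
    | zero => simp
    | succ d ih => rw [sum_Icc_succ_top (by omega), ih]; push_cast; ring
  rw [← sum_div, this, Nat.cast_sub hc]
  field_simp
  push_cast
  ring

open Polynomial in
lemma aux_F (m N : ℕ) (c : Fin m → ℕ) (hc : ∀ l, 0 < c l) (hN : N = ∑ l, c l)
    (x : ℂ) (hx : x ≠ 0) : ∃ F : ℂ[X], F.natDegree ≤ N - m ∧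
      (∀ y, F.eval y = ∏ l, ((c l : ℂ) *
              ∏ a ∈ Icc 1 (c l - 1), (((c l : ℂ) - (a : ℂ)) * y + (a : ℂ) * x))) ∧
      F.eval x = (∏ l, (c l : ℂ) ^ (c l)) * x ^ (N - m) ∧
      x * (derivative F).eval x = ((N : ℂ) - m) / 2 * F.eval x := by
  have hs : ∑ l, (c l - 1) = N - m := by
    have : ∑ l, (c l - 1) + ∑ l : Fin m, 1 = ∑ l, c l := by
      rw [← sum_add_distrib]
      exact sum_congr rfl fun l _ => by have := hc l; omega
    simp at this; omega
  refine ⟨∏ l, (C (c l : ℂ) * ∏ a ∈ Icc 1 (c l - 1),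
    (C ((c l : ℂ) - (a : ℂ)) * X + C ((a : ℂ) * x))), ?_, ?_, ?_, ?_⟩
  · refine (natDegree_prod_le _ _).trans ?_
    rw [← hs]
    refine sum_le_sum fun l _ => ?_
    refine (natDegree_C_mul_le _ _).trans ((natDegree_prod_le _ _).trans ?_)
    refine (sum_le_card_nsmul _ _ 1 fun a _ => natDegree_linear_le).trans ?_
    simp
  · intro y; simp [eval_prod]
  · simp only [eval_prod, eval_mul, eval_add, eval_C, eval_X]
    rw [← hs, ← prod_pow_eq_pow_sum, ← prod_mul_distrib]
    refine prod_congr rfl fun l _ => ?_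
    have : ∀ a ∈ Icc 1 (c l - 1), ((c l : ℂ) - a) * x + a * x = c l * x := fun a _ => by ring
    rw [prod_congr rfl this, prod_const]
    simp only [Nat.card_Icc, Nat.add_sub_cancel]
    obtain ⟨d, hd⟩ : ∃ d, c l = d + 1 := ⟨c l - 1, by have := hc l; omega⟩
    rw [hd]; simp only [Nat.add_sub_cancel]; ring
  · have key := aux_logder univ (fun l => (C (c l : ℂ) * ∏ a ∈ Icc 1 (c l - 1),
      (C ((c l : ℂ) - (a : ℂ)) * X + C ((a : ℂ) * x)))) (fun l => ((c l : ℂ) - 1) / 2) x x ?_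
    · rw [key]
      congr 1
      rw [← sum_div, hN]; simp
    · intro l _
      have hc0 : (c l : ℂ) ≠ 0 := by exact_mod_cast (hc l).ne'
      have := aux_logder (Icc 1 (c l - 1)) (fun a =>
        (C ((c l : ℂ) - (a : ℂ)) * X + C ((a : ℂ) * x))) (fun a => ((c l : ℂ) - a) / c l) x x
        (fun a _ => by
          simp
          field_simp
          ring)
      rw [aux_sum _ (hc l)] at this
      rw [derivative_C_mul, eval_mul, eval_mul, eval_C]
      linear_combination (c l : ℂ) * this

/-- Let `m ≥ 2`, `c_1, …, c_m` positive integers, `n = m − 1 + ∑ c_l`,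
`N = n − m + 1`. For pairwise distinct nonzero complex numbers `α_1, …, α_N`,
`∑_{i=1}^{N} ∑_{j≠i} [α_i^m · ∏_l (c_l · ∏_{a=1}^{c_l−1} ((c_l − a)α_j + a·α_i))
            / ((α_j − α_i)·∏_{k≠i,j}(α_j − α_k))]
    · (∑_{k≠i,j} 1/(α_i − α_k) − ∑_l 1/(c_l·α_i))
  = (∑_l 1/c_l − (n − 2m + 1)/2) · ∏_l c_l^{c_l}`. -/
theorem stmt_6 (m : ℕ) (hm : 2 ≤ m) (c : Fin m → ℕ) (hc : ∀ l, 0 < c l)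
    (n N : ℕ) (hn : n = m - 1 + ∑ l, c l) (hN : N = n - m + 1)
    (α : Fin N → ℂ) (hα : Function.Injective α) (hα0 : ∀ j, α j ≠ 0) :
    ∑ i : Fin N, ∑ j ∈ univ.erase i,
        (α i ^ m *
            (∏ l, ((c l : ℂ) *
              ∏ a ∈ Icc 1 (c l - 1), (((c l : ℂ) - (a : ℂ)) * α j + (a : ℂ) * α i))) /
            ((α j - α i) * ∏ k ∈ (univ.erase i).erase j, (α j - α k))) *
          ((∑ k ∈ (univ.erase i).erase j, 1 / (α i - α k)) -
            ∑ l, 1 / ((c l : ℂ) * α i)) =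
      ((∑ l, 1 / (c l : ℂ)) - ((n : ℂ) - 2 * m + 1) / 2) * ∏ l, (c l : ℂ) ^ (c l) := by
  have hmle : m ≤ ∑ l, c l := by
    have : ∑ l : Fin m, 1 ≤ ∑ l, c l := sum_le_sum fun l _ => hc l
    simpa using this
  have hNc : N = ∑ l, c l := by omega
  have hN2 : 2 ≤ N := by omega
  have hnN : (n : ℂ) - 2 * m + 1 = N - m := by
    have : n + 1 = N + m := by omega
    have : (n : ℂ) + 1 = N + m := by exact_mod_cast this
    linear_combination this
  have hone : ∑ i, α i ^ (N - 1) / ∏ k ∈ univ.erase i, (α i - α k) = 1 := by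
    have := Lagrange.coeff_eq_sum (s := univ) (v := α) hα.injOn
      (P := (Polynomial.X : Polynomial ℂ) ^ (N - 1)) (by
        rw [Polynomial.degree_X_pow, card_univ, Fintype.card_fin]
        exact_mod_cast (by omega : N - 1 < N))
    simp at this
    exact this.symm
  rw [hnN]
  refine Eq.trans ?_ ((congrArg (fun z => (((∑ l, 1 / (c l : ℂ)) - ((N : ℂ) - m) / 2) *
    ∏ l, (c l : ℂ) ^ (c l)) * z) hone).trans (mul_one _))
  rw [mul_sum]
  refine sum_congr rfl fun i _ => ?_
  obtain ⟨F, hFd, hF, hFx, hF'⟩ := aux_F m N c hc hNc (α i) (hα0 i)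
  have hx := hα0 i
  set x := α i with hxdef
  set D := ∏ k ∈ univ.erase i, (x - α k) with hD
  set A := ∑ k ∈ univ.erase i, 1 / (x - α k) with hA
  set s := ∑ l, 1 / (c l : ℂ) with hs
  have S1 := aux_lag α hα hN2 F (by omega) i
  have S2 := aux_dd α hα hN2 F (by omega) i
  have S3 := aux_S3 α hα hN2 i
  rw [← hxdef, ← hD] at S1 S2 S3
  rw [← hA] at S3
  have hsx : ∑ l, 1 / ((c l : ℂ) * x) = s / x := by
    rw [hs, sum_div]
    exact sum_congr rfl fun l _ => by rw [div_div]
  have hterm : ∀ j ∈ univ.erase i,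
        (x ^ m *
            (∏ l, ((c l : ℂ) *
              ∏ a ∈ Icc 1 (c l - 1), (((c l : ℂ) - (a : ℂ)) * α j + (a : ℂ) * x))) /
            ((α j - x) * ∏ k ∈ (univ.erase i).erase j, (α j - α k))) *
          ((∑ k ∈ (univ.erase i).erase j, 1 / (x - α k)) -
            ∑ l, 1 / ((c l : ℂ) * x)) =
        x ^ m * (A - s / x) * (F.eval (α j) / ∏ k ∈ univ.erase j, (α j - α k)) +
        (x ^ m * ((F.eval (α j) - F.eval x) /
            ((α j - x) * ∏ k ∈ univ.erase j, (α j - α k))) +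
          x ^ m * F.eval x * (1 / ((α j - x) * ∏ k ∈ univ.erase j, (α j - α k)))) := by
    intro j hj
    have hji := (mem_erase.1 hj).1
    have hne : α j - x ≠ 0 := sub_ne_zero.2 (fun hh => hji (hα hh))
    have hne' : x - α j ≠ 0 := sub_ne_zero.2 (fun hh => hji (hα hh).symm)
    have hDj : (α j - x) * ∏ k ∈ (univ.erase i).erase j, (α j - α k) =
        ∏ k ∈ univ.erase j, (α j - α k) := by
      rw [erase_right_comm, hxdef]
      exact mul_prod_erase (univ.erase j) (fun k => α j - α k) (mem_erase.2 ⟨hji.symm, mem_univ i⟩)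
    have hAj : ∑ k ∈ (univ.erase i).erase j, 1 / (x - α k) = A + 1 / (α j - x) := by
      rw [hA, ← add_sum_erase (univ.erase i) (fun k => 1 / (x - α k)) hj,
        ← neg_sub (α j) x, one_div_neg_eq_neg_one_div]
      ring
    have hDj0 : ∏ k ∈ univ.erase j, (α j - α k) ≠ 0 := prod_ne_zero_iff.2 fun k hk =>
      sub_ne_zero.2 (fun hh => (mem_erase.1 hk).1 (hα hh).symm)
    rw [hDj, hAj, hsx, ← hF]
    generalize ∏ k ∈ univ.erase j, (α j - α k) = Dj at *
    field_simp
    ring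
  rw [sum_congr rfl hterm, sum_add_distrib, sum_add_distrib, ← mul_sum, ← mul_sum, ← mul_sum,
    S1, S2, S3]
  have hpow : x ^ m * x ^ (N - m) = x ^ (N - 1) * x := by
    rw [← pow_add, ← pow_succ]; congr 1; omega
  have hder : (Polynomial.derivative F).eval x = ((N : ℂ) - m) / 2 * F.eval x / x := by
    rw [eq_div_iff hx, ← hF']; ring
  rw [hder, hFx]
  have : x ^ (N - 1) = x ^ m * x ^ (N - m) / x := by
    rw [hpow, mul_div_assoc, div_self hx, mul_one]
  rw [this]
  ring
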